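/- Let d ≥ 1 be an integer and β > d/2 be real. Fix a unit vector u ∈ S^{d−1}. Then there exist constants 0 < c ≤ C and r₀ > 0 such that for all r ≥ r₀, c · r^{d−2β} ≤ ∫_{{x ∈ ℝ^d : ⟨x,u⟩ ≥ r}} c̃_{d,β}(1+‖x‖²)^{−β} dx ≤ C · r^{d−2β}; i.e., the beta-prime probability content of the half-space H⁺(u,r) = {x : ⟨x,u⟩ ≥ r} is of exact order r^{−2β+d} as r → ∞. -/

import Mathlib

open MeasureTheory RealInnerProductSpace

/-- The beta-prime density on `ℝ^d` with parameter `β`. -/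
noncomputable def betaPrimeDensity (d : ℕ) (β : ℝ) (x : EuclideanSpace ℝ (Fin d)) : ℝ :=
  (Real.Gamma β / (Real.pi ^ ((d : ℝ) / 2) * Real.Gamma (β - d / 2))) * (1 + ‖x‖ ^ 2) ^ (-β)

/-- The beta-prime density is integrable for `β > d / 2`. -/
theorem integrable_betaPrimeDensity (d : ℕ) {β : ℝ} (hβ : (d : ℝ) / 2 < β) :
    Integrable (betaPrimeDensity d β) := by
  have h := integrable_rpow_neg_one_add_norm_sq (E := EuclideanSpace ℝ (Fin d))
    (μ := volume) (r := 2 * β) (by simp only [finrank_euclideanSpace, Fintype.card_fin]; linarith)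
  have e : -(2 * β) / 2 = -β := by ring
  rw [e] at h
  exact h.const_mul _

/-- The beta-prime density is positive for `β > d / 2`. -/
theorem betaPrimeDensity_pos {d : ℕ} {β : ℝ} (hβ : (d : ℝ) / 2 < β)
    (x : EuclideanSpace ℝ (Fin d)) : 0 < betaPrimeDensity d β x := by
  have hβ0 : 0 < β := lt_of_le_of_lt (by positivity) hβ
  have h1 := Real.Gamma_pos_of_pos hβ0
  have h2 := Real.Gamma_pos_of_pos (sub_pos.2 hβ)
  have := Real.pi_pos
  unfold betaPrimeDensity
  positivity

/-- Dilating by `r ≥ 1` decreases the beta-prime density by at most a factor `r ^ (-2 * β)`. -/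
theorem le_betaPrimeDensity_smul {d : ℕ} {β : ℝ} (hβ : (d : ℝ) / 2 < β) {r : ℝ} (hr : 1 ≤ r)
    (x : EuclideanSpace ℝ (Fin d)) :
    r ^ (-2 * β) * betaPrimeDensity d β x ≤ betaPrimeDensity d β (r • x) := by
  have hβ0 : 0 < β := lt_of_le_of_lt (by positivity) hβ
  have h1 := Real.Gamma_pos_of_pos hβ0
  have h2 := Real.Gamma_pos_of_pos (sub_pos.2 hβ)
  have hr0 : 0 < r := by linarith
  have key : (r ^ 2 * (1 + ‖x‖ ^ 2)) ^ (-β) ≤ (1 + ‖r • x‖ ^ 2) ^ (-β) := by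
    refine Real.rpow_le_rpow_of_nonpos (by positivity) ?_ (by linarith)
    rw [norm_smul, mul_pow, Real.norm_eq_abs, sq_abs]
    nlinarith
  rw [Real.mul_rpow (by positivity) (by positivity), ← Real.rpow_natCast_mul hr0.le] at key
  have e : ((2 : ℕ) : ℝ) * -β = -2 * β := by push_cast; ring
  rw [e] at key
  unfold betaPrimeDensity
  rw [mul_left_comm]
  gcongr

/-- Outside the unit ball, dilating by `r` decreases the beta-prime density at least by a factor
of order `r ^ (-2 * β)`. -/
theorem betaPrimeDensity_smul_le {d : ℕ} {β : ℝ} (hβ : (d : ℝ) / 2 < β) {r : ℝ} (hr : 0 < r)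
    {x : EuclideanSpace ℝ (Fin d)} (hx : 1 ≤ ‖x‖) :
    betaPrimeDensity d β (r • x) ≤ 2 ^ β * r ^ (-2 * β) * betaPrimeDensity d β x := by
  have hβ0 : 0 < β := lt_of_le_of_lt (by positivity) hβ
  have h1 := Real.Gamma_pos_of_pos hβ0
  have h2 := Real.Gamma_pos_of_pos (sub_pos.2 hβ)
  have key : (1 + ‖r • x‖ ^ 2) ^ (-β) ≤ (2⁻¹ * (r ^ 2 * (1 + ‖x‖ ^ 2))) ^ (-β) := by
    refine Real.rpow_le_rpow_of_nonpos (by positivity) ?_ (by linarith)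
    rw [norm_smul, mul_pow, Real.norm_eq_abs, sq_abs]
    nlinarith [mul_le_mul_of_nonneg_left (one_le_pow₀ hx (n := 2)) (sq_nonneg r)]
  rw [Real.mul_rpow (by positivity) (by positivity), Real.mul_rpow (by positivity) (by positivity),
    ← Real.rpow_natCast_mul hr.le, Real.inv_rpow zero_le_two, Real.rpow_neg zero_le_two,
    inv_inv, ← mul_assoc] at key
  have e : ((2 : ℕ) : ℝ) * -β = -2 * β := by push_cast; ring
  rw [e] at key
  unfold betaPrimeDensity
  rw [mul_left_comm]
  gcongr

open scoped Pointwise in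
/-- The integral over the half-space at distance `r`, rescaled to the half-space at distance `1`. -/
theorem setIntegral_halfSpace_eq_smul {d : ℕ} (f : EuclideanSpace ℝ (Fin d) → ℝ)
    (u : EuclideanSpace ℝ (Fin d)) {r : ℝ} (hr : 0 < r) :
    ∫ x in {x : EuclideanSpace ℝ (Fin d) | r ≤ ⟪x, u⟫}, f x =
      r ^ d * ∫ x in {x : EuclideanSpace ℝ (Fin d) | 1 ≤ ⟪x, u⟫}, f (r • x) := by
  have hs : r • {x : EuclideanSpace ℝ (Fin d) | 1 ≤ ⟪x, u⟫} = {x | r ≤ ⟪x, u⟫} := by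
    ext x
    rw [Set.mem_smul_set_iff_inv_smul_mem₀ hr.ne', Set.mem_ofPred_eq, Set.mem_ofPred_eq,
      real_inner_smul_left, inv_mul_eq_div, one_le_div hr]
  rw [Measure.setIntegral_comp_smul_of_pos volume f _ hr, hs, finrank_euclideanSpace,
    Fintype.card_fin, smul_eq_mul, mul_inv_cancel_left₀ (by positivity)]

/-- Half-spaces at distance `1` have positive beta-prime content. -/
theorem setIntegral_betaPrimeDensity_pos {d : ℕ} {β : ℝ} (hβ : (d : ℝ) / 2 < β)
    {u : EuclideanSpace ℝ (Fin d)} (hu : ‖u‖ = 1) :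
    0 < ∫ x in {x : EuclideanSpace ℝ (Fin d) | 1 ≤ ⟪x, u⟫}, betaPrimeDensity d β x := by
  rw [setIntegral_pos_iff_support_of_nonneg_ae
    (ae_of_all _ fun x => (betaPrimeDensity_pos hβ x).le)
    (integrable_betaPrimeDensity d hβ).integrableOn]
  have hsupp : Function.support (betaPrimeDensity d β) = Set.univ :=
    Set.eq_univ_of_forall fun x => (betaPrimeDensity_pos hβ x).ne'
  rw [hsupp, Set.univ_inter]
  have hopen : IsOpen {x : EuclideanSpace ℝ (Fin d) | 1 < ⟪x, u⟫} :=
    isOpen_lt continuous_const (by fun_prop)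
  refine (hopen.measure_pos volume ⟨(2 : ℝ) • u, ?_⟩).trans_le
    (measure_mono fun x (hx : 1 < ⟪x, u⟫) => hx.le)
  rw [Set.mem_ofPred_eq, real_inner_smul_left, real_inner_self_eq_norm_sq, hu]
  norm_num

theorem betaPrime_halfSpace_content_order (d : ℕ) (hd : 1 ≤ d) (β : ℝ)
    (hβ : (d : ℝ) / 2 < β) (u : EuclideanSpace ℝ (Fin d)) (hu : ‖u‖ = 1) :
    ∃ c C r₀ : ℝ, 0 < c ∧ c ≤ C ∧ 0 < r₀ ∧ ∀ r ≥ r₀,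
      c * r ^ ((d : ℝ) - 2 * β) ≤
        ∫ x in {x : EuclideanSpace ℝ (Fin d) | r ≤ ⟪x, u⟫}, betaPrimeDensity d β x ∧
      (∫ x in {x : EuclideanSpace ℝ (Fin d) | r ≤ ⟪x, u⟫}, betaPrimeDensity d β x) ≤
        C * r ^ ((d : ℝ) - 2 * β) := by
  have hβ0 : 0 < β := lt_of_le_of_lt (by positivity) hβ
  set I := ∫ x in {x : EuclideanSpace ℝ (Fin d) | 1 ≤ ⟪x, u⟫}, betaPrimeDensity d β x with hI
  have hIpos : 0 < I := setIntegral_betaPrimeDensity_pos hβ hu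
  refine ⟨I, 2 ^ β * I, 1, hIpos,
    le_mul_of_one_le_left hIpos.le (Real.one_le_rpow one_le_two hβ0.le), one_pos, fun r hr => ?_⟩
  have hr0 : 0 < r := one_pos.trans_le hr
  have hint := integrable_betaPrimeDensity d hβ
  have hmeas : MeasurableSet {x : EuclideanSpace ℝ (Fin d) | 1 ≤ ⟪x, u⟫} :=
    (isClosed_le continuous_const (by fun_prop)).measurableSet
  have hpow : r ^ ((d : ℝ) - 2 * β) = r ^ d * r ^ (-2 * β) := by
    rw [← Real.rpow_natCast, ← Real.rpow_add hr0]
    ring_nf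
  rw [setIntegral_halfSpace_eq_smul _ u hr0, hpow]
  constructor
  · rw [mul_left_comm, mul_comm I, hI, ← integral_const_mul]
    refine mul_le_mul_of_nonneg_left ?_ (pow_nonneg hr0.le d)
    exact setIntegral_mono (hint.const_mul _).integrableOn (hint.comp_smul hr0.ne').integrableOn
      fun x => le_betaPrimeDensity_smul hβ hr x
  · rw [mul_left_comm, mul_right_comm]
    refine mul_le_mul_of_nonneg_left ?_ (pow_nonneg hr0.le d)
    rw [hI, ← integral_const_mul]
    refine setIntegral_mono_on (hint.comp_smul hr0.ne').integrableOn
      (hint.const_mul _).integrableOn hmeas fun x hx => betaPrimeDensity_smul_le hβ hr0 ?_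
    have h := hx.out.trans (real_inner_le_norm x u)
    rwa [hu, mul_one] at h
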